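/- There exist i₀ ≥ 1 and constants 0 < c ≤ C such that for all i ≥ i₀ and all k ≥ 0, writing w = R_i·R_{i+2}·⋯·R_{i+2k} e₂ ∈ ℝ⁹, both the 8-th and the 9-th coordinates of w satisfy c·φ^{−2(a_{i+1}−a_i)} ≤ w_8 ≤ C·φ^{−2(a_{i+1}−a_i)} and c·φ^{−2(a_{i+1}−a_i)} ≤ w_9 ≤ C·φ^{−2(a_{i+1}−a_i)}. -/

import Mathlib

open Filter Finset Matrix

/-- The golden ratio φ = (1+√5)/2. -/
noncomputable def goldphi : ℝ := (1 + Real.sqrt 5) / 2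

/-- The matrix `A`: identity in rows 1–7, row 8 = (0,0,0,0,0,1,1,1,1),
row 9 = (0,0,0,1,1,2,0,1,2). -/
def Amat : Matrix (Fin 9) (Fin 9) ℝ :=
  !![1,0,0,0,0,0,0,0,0;
     0,1,0,0,0,0,0,0,0;
     0,0,1,0,0,0,0,0,0;
     0,0,0,1,0,0,0,0,0;
     0,0,0,0,1,0,0,0,0;
     0,0,0,0,0,1,0,0,0;
     0,0,0,0,0,0,1,0,0;
     0,0,0,0,0,1,1,1,1;
     0,0,0,1,1,2,0,1,2]

/-- The matrix `M` with rows e₆, e₉, e₈, e₂, e₄+e₅, e₇, e₁+e₃, e₃, e₄. -/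
def Mmat : Matrix (Fin 9) (Fin 9) ℝ :=
  !![0,0,0,0,0,1,0,0,0;
     0,0,0,0,0,0,0,0,1;
     0,0,0,0,0,0,0,1,0;
     0,1,0,0,0,0,0,0,0;
     0,0,0,1,1,0,0,0,0;
     0,0,0,0,0,0,1,0,0;
     1,0,1,0,0,0,0,0,0;
     0,0,1,0,0,0,0,0,0;
     0,0,0,1,0,0,0,0,0]

/-- The rank-one limit matrix `L`, nonzero only in rows 2 and 3. -/
noncomputable def Lmat : Matrix (Fin 9) (Fin 9) ℝ :=
  !![0,0,0,0,0,0,0,0,0;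
     (Real.sqrt 5 - 1)/4, 1/2, (1 + Real.sqrt 5)/4, (3 + Real.sqrt 5)/4, 1/2, 0, (3 + Real.sqrt 5)/4, 0, 0;
     (3 - Real.sqrt 5)/4, (Real.sqrt 5 - 1)/4, 1/2, (1 + Real.sqrt 5)/4, (Real.sqrt 5 - 1)/4, 0, (1 + Real.sqrt 5)/4, 0, 0;
     0,0,0,0,0,0,0,0,0;
     0,0,0,0,0,0,0,0,0;
     0,0,0,0,0,0,0,0,0;
     0,0,0,0,0,0,0,0,0;
     0,0,0,0,0,0,0,0,0;
     0,0,0,0,0,0,0,0,0]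

/-- `a_i = r_i - 1`. -/
def aseq (r : ℕ → ℕ) (i : ℕ) : ℕ := r i - 1

/-- `c_i = (2/√5)·φ^{2 a_i}`. -/
noncomputable def cseq (r : ℕ → ℕ) (i : ℕ) : ℝ :=
  (2 / Real.sqrt 5) * goldphi ^ (2 * aseq r i)

/-- `P_i = A^{a_i} M A^{a_{i+1}} M`. -/
noncomputable def Pmat (r : ℕ → ℕ) (i : ℕ) : Matrix (Fin 9) (Fin 9) ℝ :=
  Amat ^ (aseq r i) * Mmat * Amat ^ (aseq r (i+1)) * Mmat

/-- `R_i = P_i / c_{i+1}`. -/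
noncomputable def Rmat (r : ℕ → ℕ) (i : ℕ) : Matrix (Fin 9) (Fin 9) ℝ :=
  (cseq r (i+1))⁻¹ • Pmat r i

/-- The Frobenius norm of a square real matrix. -/
noncomputable def frobNorm {n : ℕ} (X : Matrix (Fin n) (Fin n) ℝ) : ℝ :=
  Real.sqrt (∑ i, ∑ j, (X i j)^2)

/-- The hypotheses on the sequence `r`: `r 1 = 1`, `r 2 = 2`, and the sequence of
differences `n ↦ r (n+1) - r n` (for `n ≥ 1`) is strictly increasing. -/
def GoodSeq (r : ℕ → ℕ) : Prop :=
  r 1 = 1 ∧ r 2 = 2 ∧ ∀ n, 1 ≤ n → r (n+1) - r n < r (n+2) - r (n+1)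

/-! ### Explicit action of the matrices -/

/-- The pair `(F_{2n-1}, F_{2n})` as real numbers. -/
def fibPair : ℕ → ℝ × ℝ
  | 0 => (1, 0)
  | n + 1 => ((fibPair n).1 + (fibPair n).2, (fibPair n).1 + 2 * (fibPair n).2)

lemma Amat_mulVec (v : Fin 9 → ℝ) :
    Amat *ᵥ v = ![v 0, v 1, v 2, v 3, v 4, v 5, v 6, v 5 + v 6 + v 7 + v 8,
      v 3 + v 4 + 2 * v 5 + v 7 + 2 * v 8] := by
  funext j
  fin_cases j <;> simp [Amat, Matrix.mulVec, dotProduct, Fin.sum_univ_succ] <;> ring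

lemma Mmat_mulVec (v : Fin 9 → ℝ) :
    Mmat *ᵥ v = ![v 5, v 8, v 7, v 1, v 3 + v 4, v 6, v 0 + v 2, v 2, v 3] := by
  funext j
  fin_cases j <;> simp [Mmat, Matrix.mulVec, dotProduct, Fin.sum_univ_succ]

/-- Eighth coordinate of `A^n v`, in terms of `(d, e) = (F_{2n-1}, F_{2n})`. -/
def bot7 (d e g : ℝ) (s t y z : ℝ) : ℝ := d * y + e * z + (e - d + g) * s + (d - g) * t

/-- Ninth coordinate of `A^n v`. -/
def bot8 (d e g : ℝ) (s t y z : ℝ) : ℝ := e * y + (d + e) * z + (d - g) * s + e * t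

lemma Apow_mulVec (n : ℕ) (v : Fin 9 → ℝ) :
    (Amat ^ n) *ᵥ v = ![v 0, v 1, v 2, v 3, v 4, v 5, v 6,
      bot7 (fibPair n).1 (fibPair n).2 1 (v 5 + v 6) (v 3 + v 4 + 2 * v 5) (v 7) (v 8),
      bot8 (fibPair n).1 (fibPair n).2 1 (v 5 + v 6) (v 3 + v 4 + 2 * v 5) (v 7) (v 8)] := by
  induction n with
  | zero =>
    funext j
    fin_cases j <;> simp [fibPair, bot7, bot8]
  | succ n ih =>
    rw [pow_succ', ← Matrix.mulVec_mulVec, ih, Amat_mulVec]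
    funext j
    fin_cases j <;> simp [fibPair, bot7, bot8] <;> ring

lemma Pmat_mulVec (r : ℕ → ℕ) (i : ℕ) (v : Fin 9 → ℝ) :
    Pmat r i *ᵥ v = ![v 6,
      bot8 (fibPair (aseq r (i+1))).1 (fibPair (aseq r (i+1))).2 1
        (v 6 + (v 0 + v 2)) (v 1 + (v 3 + v 4) + 2 * v 6) (v 2) (v 3),
      bot7 (fibPair (aseq r (i+1))).1 (fibPair (aseq r (i+1))).2 1
        (v 6 + (v 0 + v 2)) (v 1 + (v 3 + v 4) + 2 * v 6) (v 2) (v 3),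
      v 8, v 1 + (v 3 + v 4), v 0 + v 2, v 5 + v 7,
      bot7 (fibPair (aseq r i)).1 (fibPair (aseq r i)).2 1
        (v 0 + v 2 + (v 5 + v 7)) (v 8 + (v 1 + (v 3 + v 4)) + 2 * (v 0 + v 2)) (v 7) (v 1),
      bot8 (fibPair (aseq r i)).1 (fibPair (aseq r i)).2 1
        (v 0 + v 2 + (v 5 + v 7)) (v 8 + (v 1 + (v 3 + v 4)) + 2 * (v 0 + v 2)) (v 7) (v 1)] := by
  unfold Pmat
  rw [← Matrix.mulVec_mulVec, ← Matrix.mulVec_mulVec, ← Matrix.mulVec_mulVec, Mmat_mulVec v,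
    Apow_mulVec, Mmat_mulVec, Apow_mulVec]
  funext j
  fin_cases j <;> simp

/-! ### Golden ratio facts -/

lemma phi_sq : goldphi ^ 2 = goldphi + 1 := by
  have h : Real.sqrt 5 ^ 2 = 5 := Real.sq_sqrt (by norm_num)
  unfold goldphi; nlinarith

lemma sqrt5_eq : Real.sqrt 5 = 2 * goldphi - 1 := by unfold goldphi; ring

lemma phi_lb : 1.61 ≤ goldphi := by
  have : (2.22 : ℝ) ≤ Real.sqrt 5 := Real.le_sqrt_of_sq_le (by norm_num)
  unfold goldphi; linarith

lemma phi_ub : goldphi ≤ 1.62 := by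
  have : Real.sqrt 5 ≤ 2.24 := Real.sqrt_le_iff.2 (by norm_num)
  unfold goldphi; linarith

lemma phi_pos : 0 < goldphi := by linarith [phi_lb]

lemma phi_inv_mul (m : ℕ) : goldphi ^ (2 * m) * (goldphi - 1) ^ (2 * m) = 1 := by
  rw [← mul_pow]
  have : goldphi * (goldphi - 1) = 1 := by nlinarith [phi_sq]
  rw [this, one_pow]

lemma fibPair_closed (n : ℕ) :
    (2 * goldphi - 1) * (fibPair n).1 =
      (goldphi - 1) * goldphi ^ (2 * n) + goldphi * (goldphi - 1) ^ (2 * n) ∧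
    (2 * goldphi - 1) * (fibPair n).2 = goldphi ^ (2 * n) - (goldphi - 1) ^ (2 * n) := by
  induction n with
  | zero => simp [fibPair]; ring
  | succ n ih =>
    obtain ⟨h1, h2⟩ := ih
    have h : goldphi ^ 2 = goldphi + 1 := phi_sq
    have e1 : goldphi ^ (2 * (n + 1)) = goldphi ^ (2 * n) * (goldphi + 1) := by
      rw [← h]; ring
    have e2 : (goldphi - 1) ^ (2 * (n + 1)) = (goldphi - 1) ^ (2 * n) * (2 - goldphi) := by
      have : (goldphi - 1) ^ 2 = 2 - goldphi := by nlinarith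
      rw [← this]; ring
    rw [e1, e2]
    simp only [fibPair]
    constructor
    · linear_combination h1 + h2 + (- goldphi ^ (2 * n) + (goldphi - 1) ^ (2 * n)) * h
    · linear_combination h1 + 2 * h2

lemma fibPair_bounds (n : ℕ) :
    1 ≤ (fibPair n).1 ∧ 0 ≤ (fibPair n).2 ∧ 0 ≤ (fibPair n).2 - (fibPair n).1 + 1 := by
  induction n with
  | zero => simp [fibPair]
  | succ n ih =>
    obtain ⟨h1, h2, h3⟩ := ih
    simp only [fibPair]
    refine ⟨by linarith, by linarith, by linarith⟩

lemma bot7_smul (a d e g s t y z : ℝ) :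
    a * bot7 d e g s t y z = bot7 (a * d) (a * e) (a * g) s t y z := by unfold bot7; ring

lemma bot8_smul (a d e g s t y z : ℝ) :
    a * bot8 d e g s t y z = bot8 (a * d) (a * e) (a * g) s t y z := by unfold bot8; ring

/-! ### The two functionals -/

/-- The left eigenfunctional of the limit matrix. -/
noncomputable def ell (v : Fin 9 → ℝ) : ℝ :=
  (goldphi - 1) * v 0 + v 1 + goldphi * v 2 + (goldphi + 1) * v 3 + v 4 + (goldphi + 1) * v 6

/-- A strictly positive functional dominating all coordinates. -/
noncomputable def tot (v : Fin 9 → ℝ) : ℝ := ell v + v 5 + v 7 + v 8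

lemma tot_ge (v : Fin 9 → ℝ) (hv : ∀ j, 0 ≤ v j) :
    v 0 + v 1 + v 2 + v 3 + v 4 + v 5 + v 6 + v 7 + v 8 ≤ 2 * tot v := by
  have h1 := phi_lb
  unfold tot ell
  nlinarith [mul_nonneg (sub_nonneg.2 h1) (hv 0), mul_nonneg (sub_nonneg.2 h1) (hv 2),
    mul_nonneg (sub_nonneg.2 h1) (hv 3), mul_nonneg (sub_nonneg.2 h1) (hv 6), hv 0, hv 1, hv 2,
    hv 3, hv 4, hv 5, hv 6, hv 7, hv 8]

/-- Estimates on the bottom block for the big exponent. -/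
lemma big_est (Y : ℝ) (hY0 : 0 ≤ Y) (hY1 : Y ≤ 1) (E D G : ℝ)
    (hE : E = (1 - Y ^ 2) / 2) (hD : D = ((goldphi - 1) + goldphi * Y ^ 2) / 2)
    (hG : G = (2 * goldphi - 1) * Y / 2) :
    (1 - 10 * Y) / 2 ≤ E ∧ E ≤ 1 / 2 ∧ (goldphi - 1) * (1 - 10 * Y) / 2 ≤ D - G ∧
    (goldphi - 1) * (1 - 10 * Y) / 2 ≤ D ∧ D ≤ (goldphi - 1) / 2 + Y ∧
    (2 - goldphi) * (1 - 10 * Y) / 2 ≤ E - D + G ∧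
    E - D + G ≤ (2 - goldphi) / 2 + 2 * Y ∧ G ≤ 2 * Y ∧ 0 ≤ G := by
  have h1 := phi_lb
  have h2 := phi_ub
  have hYY : Y ^ 2 ≤ Y := by nlinarith
  have hY2 : 0 ≤ Y ^ 2 := sq_nonneg Y
  have p1 := mul_nonneg (sub_nonneg.2 h1) hY0
  have p2 := mul_nonneg (sub_nonneg.2 h2) hY0
  have p3 := mul_nonneg (sub_nonneg.2 h1) hY2
  have p4 := mul_nonneg (sub_nonneg.2 h2) hY2
  subst hE hD hG
  refine ⟨?_, ?_, ?_, ?_, ?_, ?_, ?_, ?_, ?_⟩ <;> nlinarith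

lemma core_lower (v : Fin 9 → ℝ) (hv : ∀ j, 0 ≤ v j) (Y E D G : ℝ)
    (hE : (1 - 10 * Y) / 2 ≤ E) (hDG : (goldphi - 1) * (1 - 10 * Y) / 2 ≤ D - G)
    (hD : (goldphi - 1) * (1 - 10 * Y) / 2 ≤ D)
    (hF : (2 - goldphi) * (1 - 10 * Y) / 2 ≤ E - D + G) :
    (1 - 10 * Y) * ell v / 2 ≤
      bot8 D E G (v 6 + (v 0 + v 2)) (v 1 + (v 3 + v 4) + 2 * v 6) (v 2) (v 3) ∧
    (1 - 10 * Y) * ell v / 2 * (goldphi - 1) ≤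
      bot7 D E G (v 6 + (v 0 + v 2)) (v 1 + (v 3 + v 4) + 2 * v 6) (v 2) (v 3) := by
  have hs : 0 ≤ v 6 + (v 0 + v 2) := by linarith [hv 6, hv 0, hv 2]
  have ht : 0 ≤ v 1 + (v 3 + v 4) + 2 * v 6 := by linarith [hv 6, hv 1, hv 3, hv 4]
  have h := phi_sq
  constructor
  · calc _ = bot8 ((goldphi - 1) * (1 - 10 * Y) / 2) ((1 - 10 * Y) / 2) 0
          (v 6 + (v 0 + v 2)) (v 1 + (v 3 + v 4) + 2 * v 6) (v 2) (v 3) := by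
          unfold ell bot8; ring
      _ ≤ _ := by
          unfold bot8
          have := hv 2
          have := hv 3
          rw [sub_zero]
          gcongr
  · calc _ = ((goldphi - 1) * (1 - 10 * Y) / 2) * v 2 + (1 - 10 * Y) / 2 * v 3 +
            ((2 - goldphi) * (1 - 10 * Y) / 2) * (v 6 + (v 0 + v 2)) +
            ((goldphi - 1) * (1 - 10 * Y) / 2) * (v 1 + (v 3 + v 4) + 2 * v 6) := by
          unfold ell
          linear_combination ((1 - 10 * Y) / 2 * (v 0 + v 2 + v 3 + v 6)) * h
      _ ≤ _ := by
          unfold bot7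
          have := hv 2
          have := hv 3
          gcongr

lemma core_upper (v : Fin 9 → ℝ) (hv : ∀ j, 0 ≤ v j) (Y E D G : ℝ) (hY0 : 0 ≤ Y)
    (hE : E ≤ 1 / 2) (hG : 0 ≤ G) (hD : D ≤ (goldphi - 1) / 2 + Y)
    (hF : E - D + G ≤ (2 - goldphi) / 2 + 2 * Y) :
    bot8 D E G (v 6 + (v 0 + v 2)) (v 1 + (v 3 + v 4) + 2 * v 6) (v 2) (v 3)
      ≤ ell v / 2 + 4 * Y * tot v ∧
    bot7 D E G (v 6 + (v 0 + v 2)) (v 1 + (v 3 + v 4) + 2 * v 6) (v 2) (v 3) ≤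
      ell v / 2 * (goldphi - 1) + 8 * Y * tot v := by
  have hs : 0 ≤ v 6 + (v 0 + v 2) := by linarith [hv 6, hv 0, hv 2]
  have ht : 0 ≤ v 1 + (v 3 + v 4) + 2 * v 6 := by linarith [hv 6, hv 1, hv 3, hv 4]
  have h := phi_sq
  have hT := mul_le_mul_of_nonneg_left (tot_ge v hv) hY0
  have hDG : D - G ≤ (goldphi - 1) / 2 + Y := by linarith
  have w := fun j => mul_nonneg hY0 (hv j)
  constructor
  · calc _ ≤ 1 / 2 * v 2 + ((goldphi - 1) / 2 + Y + 1 / 2) * v 3 +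
            ((goldphi - 1) / 2 + Y) * (v 6 + (v 0 + v 2)) +
            1 / 2 * (v 1 + (v 3 + v 4) + 2 * v 6) := by
          unfold bot8
          have := hv 2
          have := hv 3
          gcongr
      _ = ell v / 2 + Y * (v 3 + v 6 + v 0 + v 2) := by unfold ell; ring
      _ ≤ _ := by nlinarith [w 0, w 1, w 2, w 3, w 4, w 5, w 6, w 7, w 8]
  · calc _ ≤ ((goldphi - 1) / 2 + Y) * v 2 + 1 / 2 * v 3 +
            ((2 - goldphi) / 2 + 2 * Y) * (v 6 + (v 0 + v 2)) +
            ((goldphi - 1) / 2 + Y) * (v 1 + (v 3 + v 4) + 2 * v 6) := by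
          unfold bot7
          have := hv 2
          have := hv 3
          gcongr
      _ = ell v / 2 * (goldphi - 1) +
            Y * (v 2 + 2 * (v 6 + (v 0 + v 2)) + (v 1 + (v 3 + v 4) + 2 * v 6)) := by
          unfold ell
          linear_combination (-1 / 2 * (v 0 + v 2 + v 3 + v 6)) * h
      _ ≤ _ := by nlinarith [w 0, w 1, w 2, w 3, w 4, w 5, w 6, w 7, w 8]

/-- Upper bound for the block with the small exponent. -/
lemma small_upper (v : Fin 9 → ℝ) (hv : ∀ j, 0 ≤ v j) (q e d g : ℝ) (hq : 0 ≤ q)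
    (he : e ≤ 2 * q) (hd : d ≤ 2 * q) (hd0 : 0 ≤ d) (hg : g ≤ 2 * q) (hg0 : 0 ≤ g) :
    bot7 d e g (v 0 + v 2 + (v 5 + v 7)) (v 8 + (v 1 + (v 3 + v 4)) + 2 * (v 0 + v 2)) (v 7) (v 1)
      ≤ 40 * q * tot v ∧
    bot8 d e g (v 0 + v 2 + (v 5 + v 7)) (v 8 + (v 1 + (v 3 + v 4)) + 2 * (v 0 + v 2)) (v 7) (v 1)
      ≤ 40 * q * tot v := by
  have hs : 0 ≤ v 0 + v 2 + (v 5 + v 7) := by linarith [hv 0, hv 2, hv 5, hv 7]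
  have ht : 0 ≤ v 8 + (v 1 + (v 3 + v 4)) + 2 * (v 0 + v 2) := by
    linarith [hv 0, hv 1, hv 2, hv 3, hv 4, hv 8]
  have hT := mul_le_mul_of_nonneg_left (tot_ge v hv) hq
  have w := fun j => mul_nonneg hq (hv j)
  have h7 := hv 7
  have h1 := hv 1
  have f1 : e - d + g ≤ 4 * q := by linarith
  have f2 : d - g ≤ 2 * q := by linarith
  have f3 : d + e ≤ 4 * q := by linarith
  constructor
  · calc _ ≤ 2 * q * v 7 + 2 * q * v 1 + 4 * q * (v 0 + v 2 + (v 5 + v 7)) +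
          2 * q * (v 8 + (v 1 + (v 3 + v 4)) + 2 * (v 0 + v 2)) := by
          unfold bot7; gcongr
      _ ≤ _ := by nlinarith [w 0, w 1, w 2, w 3, w 4, w 5, w 6, w 7, w 8]
  · calc _ ≤ 2 * q * v 7 + 4 * q * v 1 + 2 * q * (v 0 + v 2 + (v 5 + v 7)) +
          2 * q * (v 8 + (v 1 + (v 3 + v 4)) + 2 * (v 0 + v 2)) := by
          unfold bot8; gcongr
      _ ≤ _ := by nlinarith [w 0, w 1, w 2, w 3, w 4, w 5, w 6, w 7, w 8]

set_option maxHeartbeats 2000000 in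
/-- One step: all needed estimates on `R_i v`. -/
lemma step (r : ℕ → ℕ) (i : ℕ) (q : ℝ) (v : Fin 9 → ℝ) (hv : ∀ j, 0 ≤ v j)
    (hq : q = goldphi ^ (2 * aseq r i) * (goldphi - 1) ^ (2 * aseq r (i+1)))
    (hn : 1 ≤ aseq r i) (hq10 : 10 * q ≤ 1) :
    (∀ j, 0 ≤ (Rmat r i *ᵥ v) j) ∧
    (1 - 10 * q) * ell v ≤ ell (Rmat r i *ᵥ v) ∧
    tot (Rmat r i *ᵥ v) ≤ (1 + 200 * q) * tot v ∧
    (1 - 10 * q) * ell v / 2 ≤ (Rmat r i *ᵥ v) 1 ∧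
    q / 4 * v 1 ≤ (Rmat r i *ᵥ v) 7 ∧ (Rmat r i *ᵥ v) 7 ≤ 40 * q * tot v ∧
    q / 4 * v 1 ≤ (Rmat r i *ᵥ v) 8 ∧ (Rmat r i *ᵥ v) 8 ≤ 40 * q * tot v := by
  have p1 := phi_lb
  have p2 := phi_ub
  have psq := phi_sq
  set n := aseq r i with hndef
  set m := aseq r (i+1) with hmdef
  set X := goldphi ^ (2 * m) with hX
  set Y := (goldphi - 1) ^ (2 * m) with hY
  set Z := goldphi ^ (2 * n) with hZ
  set W := (goldphi - 1) ^ (2 * n) with hW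
  have hXY : X * Y = 1 := phi_inv_mul m
  have hZW : Z * W = 1 := phi_inv_mul n
  have hY0 : 0 ≤ Y := pow_nonneg (by linarith) _
  have hW0 : 0 ≤ W := pow_nonneg (by linarith) _
  have hX0 : 0 < X := by have := phi_pos; positivity
  have hY1 : Y ≤ 1 := pow_le_one₀ (by linarith) (by linarith)
  have hZ2 : 2 ≤ Z := by
    have : goldphi ^ 2 ≤ Z := pow_le_pow_right₀ (by linarith) (by omega)
    linarith
  have hW2 : W ≤ 1 / 2 := by nlinarith
  have hYq : Y ≤ q := by rw [hq]; nlinarith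
  have hq0 : 0 ≤ q := hY0.trans hYq
  obtain ⟨dm, em⟩ := fibPair_closed m
  obtain ⟨dn, en⟩ := fibPair_closed n
  obtain ⟨bm1, bm2, bm3⟩ := fibPair_bounds m
  obtain ⟨bn1, bn2, bn3⟩ := fibPair_bounds n
  rw [← hX, ← hY] at dm em
  rw [← hZ, ← hW] at dn en
  -- the normalising factor
  set G : ℝ := (2 * goldphi - 1) * Y / 2 with hG
  have hc : (cseq r (i+1))⁻¹ = G := by
    have hs : (2 * goldphi - 1) ≠ 0 := by linarith
    rw [cseq, sqrt5_eq, ← hmdef, ← hX, inv_eq_iff_eq_inv, hG, eq_comm, inv_eq_iff_eq_inv, eq_comm]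
    rw [mul_inv, inv_div, inv_eq_of_mul_eq_one_right hXY]
    ring
  have hR : ∀ j, (Rmat r i *ᵥ v) j = G * (Pmat r i *ᵥ v) j := by
    intro j
    rw [Rmat, Matrix.smul_mulVec, hc]; rfl
  have hP := Pmat_mulVec r i v
  rw [← hndef, ← hmdef] at hP
  have hGm : G * (fibPair m).1 = ((goldphi - 1) + goldphi * Y ^ 2) / 2 := by
    rw [hG]; linear_combination Y / 2 * dm + (goldphi - 1) / 2 * hXY
  have hGe : G * (fibPair m).2 = (1 - Y ^ 2) / 2 := by
    rw [hG]; linear_combination Y / 2 * em + 1 / 2 * hXY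
  obtain ⟨c1, c2, c3, c4, c5, c6, c7, c8, c9⟩ := big_est Y hY0 hY1 _ _ G hGe hGm hG
  obtain ⟨l1, l2⟩ := core_lower v hv Y _ _ G c1 c3 c4 c6
  obtain ⟨u1, u2⟩ := core_upper v hv Y _ _ G hY0 c2 c9 c5 c7
  have hYW : Y * W ≤ q / 4 := by
    rw [hq]
    have : W ≤ Z / 4 := by linarith
    linarith [mul_le_mul_of_nonneg_left this hY0]
  have hYW0 : 0 ≤ Y * W := by positivity
  have hGdn : G * (fibPair n).1 = ((goldphi - 1) * q + goldphi * (Y * W)) / 2 := by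
    rw [hG, hq]; linear_combination Y / 2 * dn
  have hGen : G * (fibPair n).2 = (q - Y * W) / 2 := by
    rw [hG, hq]; linear_combination Y / 2 * en
  have hen : q / 4 ≤ G * (fibPair n).2 := by rw [hGen]; linarith
  obtain ⟨s1, s2⟩ := small_upper v hv q (G * (fibPair n).2) (G * (fibPair n).1) G hq0
    (by rw [hGen]; linarith)
    (by rw [hGdn]; linarith [mul_le_mul_of_nonneg_right p2 hq0, mul_le_mul_of_nonneg_right p2 hYW0])
    (mul_nonneg c9 (by linarith)) (by linarith) c9
  have hs : 0 ≤ v 0 + v 2 + (v 5 + v 7) := by linarith [hv 0, hv 2, hv 5, hv 7]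
  have ht : 0 ≤ v 8 + (v 1 + (v 3 + v 4)) + 2 * (v 0 + v 2) := by
    linarith [hv 0, hv 1, hv 2, hv 3, hv 4, hv 8]
  have k1 : 0 ≤ G * (fibPair n).1 - G := by
    have := mul_nonneg c9 (sub_nonneg.2 bn1); linarith
  have k2 : 0 ≤ G * (fibPair n).2 - G * (fibPair n).1 + G := by
    have := mul_nonneg c9 bn3; linarith
  have k3 : 0 ≤ G * (fibPair n).1 := by linarith
  have k4 : 0 ≤ G * (fibPair n).2 := mul_nonneg c9 bn2
  have v1 := hv 1
  have v7 := hv 7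
  have lo7 : q / 4 * v 1 ≤ bot7 (G * (fibPair n).1) (G * (fibPair n).2) G
      (v 0 + v 2 + (v 5 + v 7)) (v 8 + (v 1 + (v 3 + v 4)) + 2 * (v 0 + v 2)) (v 7) (v 1) := by
    unfold bot7
    linarith [mul_nonneg k3 v7, mul_nonneg k2 hs, mul_nonneg k1 ht,
      mul_le_mul_of_nonneg_right hen v1]
  have lo8 : q / 4 * v 1 ≤ bot8 (G * (fibPair n).1) (G * (fibPair n).2) G
      (v 0 + v 2 + (v 5 + v 7)) (v 8 + (v 1 + (v 3 + v 4)) + 2 * (v 0 + v 2)) (v 7) (v 1) := by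
    unfold bot8
    linarith [mul_nonneg k4 v7, mul_nonneg k1 hs, mul_nonneg k4 ht, mul_nonneg k3 v1,
      mul_le_mul_of_nonneg_right hen v1]
  have r0 : (Rmat r i *ᵥ v) 0 = G * v 6 := by rw [hR, hP]; rfl
  have r1 : (Rmat r i *ᵥ v) 1 = bot8 (G * (fibPair m).1) (G * (fibPair m).2) G
      (v 6 + (v 0 + v 2)) (v 1 + (v 3 + v 4) + 2 * v 6) (v 2) (v 3) := by
    rw [hR, hP]; simp [bot8_smul]
  have r2 : (Rmat r i *ᵥ v) 2 = bot7 (G * (fibPair m).1) (G * (fibPair m).2) G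
      (v 6 + (v 0 + v 2)) (v 1 + (v 3 + v 4) + 2 * v 6) (v 2) (v 3) := by
    rw [hR, hP]; simp [bot7_smul]
  have r3 : (Rmat r i *ᵥ v) 3 = G * v 8 := by rw [hR, hP]; rfl
  have r4 : (Rmat r i *ᵥ v) 4 = G * (v 1 + (v 3 + v 4)) := by rw [hR, hP]; rfl
  have r5 : (Rmat r i *ᵥ v) 5 = G * (v 0 + v 2) := by rw [hR, hP]; rfl
  have r6 : (Rmat r i *ᵥ v) 6 = G * (v 5 + v 7) := by rw [hR, hP]; rfl
  have r7 : (Rmat r i *ᵥ v) 7 = bot7 (G * (fibPair n).1) (G * (fibPair n).2) G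
      (v 0 + v 2 + (v 5 + v 7)) (v 8 + (v 1 + (v 3 + v 4)) + 2 * (v 0 + v 2)) (v 7) (v 1) := by
    rw [hR, hP]; simp [bot7_smul]
  have r8 : (Rmat r i *ᵥ v) 8 = bot8 (G * (fibPair n).1) (G * (fibPair n).2) G
      (v 0 + v 2 + (v 5 + v 7)) (v 8 + (v 1 + (v 3 + v 4)) + 2 * (v 0 + v 2)) (v 7) (v 1) := by
    rw [hR, hP]; simp [bot8_smul]
  rw [← r1] at l1 u1
  rw [← r2] at l2 u2
  rw [← r7] at s1 lo7
  rw [← r8] at s2 lo8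
  have hell : 0 ≤ ell v := by
    unfold ell
    have := mul_nonneg (by linarith : (0:ℝ) ≤ goldphi - 1) (hv 0)
    have := mul_nonneg (by linarith : (0:ℝ) ≤ goldphi) (hv 2)
    have := mul_nonneg (by linarith : (0:ℝ) ≤ goldphi + 1) (hv 3)
    have := mul_nonneg (by linarith : (0:ℝ) ≤ goldphi + 1) (hv 6)
    linarith [hv 4]
  have htot : 0 ≤ tot v := by unfold tot; linarith [hv 5, hv 8]
  have m0 : 1 - 10 * q ≤ 1 - 10 * Y := by linarith
  have m1 : (1 - 10 * q) * ell v ≤ (1 - 10 * Y) * ell v := mul_le_mul_of_nonneg_right m0 hell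
  have m2 : 0 ≤ (1 - 10 * Y) * ell v := mul_nonneg (by linarith) hell
  have n0 : 0 ≤ (Rmat r i *ᵥ v) 0 := by rw [r0]; exact mul_nonneg c9 (hv 6)
  have n1 : 0 ≤ (Rmat r i *ᵥ v) 1 := by linarith
  have n2 : 0 ≤ (Rmat r i *ᵥ v) 2 := by
    have := mul_nonneg m2 (by linarith : (0:ℝ) ≤ goldphi - 1)
    linarith
  have n3 : 0 ≤ (Rmat r i *ᵥ v) 3 := by rw [r3]; exact mul_nonneg c9 (hv 8)
  have n4 : 0 ≤ (Rmat r i *ᵥ v) 4 := by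
    rw [r4]; exact mul_nonneg c9 (by linarith [hv 3, hv 4])
  have n5 : 0 ≤ (Rmat r i *ᵥ v) 5 := by
    rw [r5]; exact mul_nonneg c9 (by linarith [hv 0, hv 2])
  have n6 : 0 ≤ (Rmat r i *ᵥ v) 6 := by
    rw [r6]; exact mul_nonneg c9 (by linarith [hv 5, hv 7])
  have hqv := mul_nonneg hq0 v1
  have n7 : 0 ≤ (Rmat r i *ᵥ v) 7 := by linarith
  have n8 : 0 ≤ (Rmat r i *ᵥ v) 8 := by linarith
  have hφ1 : goldphi * (goldphi - 1) = 1 := by linarith [psq, sq goldphi, mul_sub goldphi goldphi 1]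
  refine ⟨?_, ?_, ?_, by linarith, lo7, s1, lo8, s2⟩
  · intro j; fin_cases j <;> assumption
  · have h2 := mul_le_mul_of_nonneg_left l2 (by linarith : (0:ℝ) ≤ goldphi)
    have h3 : goldphi * ((1 - 10 * Y) * ell v / 2 * (goldphi - 1)) = (1 - 10 * Y) * ell v / 2 := by
      linear_combination (1 - 10 * Y) * ell v / 2 * hφ1
    have := mul_nonneg (by linarith : (0:ℝ) ≤ goldphi - 1) n0
    have := mul_nonneg (by linarith : (0:ℝ) ≤ goldphi + 1) n3
    have := mul_nonneg (by linarith : (0:ℝ) ≤ goldphi + 1) n6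
    have he : ell (Rmat r i *ᵥ v) = _ := rfl
    conv_rhs at he => rw [ell]
    linarith
  · have h2 := mul_le_mul_of_nonneg_left u2 (by linarith : (0:ℝ) ≤ goldphi)
    have h3 : goldphi * (ell v / 2 * (goldphi - 1) + 8 * Y * tot v) =
        ell v / 2 + goldphi * (8 * Y * tot v) := by
      linear_combination ell v / 2 * hφ1
    have hYt : Y * tot v ≤ q * tot v := mul_le_mul_of_nonneg_right hYq htot
    have hYt0 : 0 ≤ Y * tot v := mul_nonneg hY0 htot
    have h4 : goldphi * (8 * Y * tot v) ≤ 16 * (q * tot v) := by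
      linarith [mul_le_mul_of_nonneg_right p2 hYt0]
    have hsum : G * (v 0 + v 1 + v 2 + v 3 + v 4 + v 5 + v 6 + v 7 + v 8) ≤ 4 * (q * tot v) := by
      calc _ ≤ (2 * Y) * (2 * tot v) := by
            apply mul_le_mul c8 (tot_ge v hv) _ (by linarith)
            linarith [hv 0, hv 2, hv 3, hv 4, hv 5, hv 6, hv 8]
        _ ≤ _ := by linarith
    have w := fun j => mul_nonneg c9 (hv j)
    have t0 : (Rmat r i *ᵥ v) 0 ≤ 4 * (q * tot v) := by
      rw [r0]; linarith [w 0, w 1, w 2, w 3, w 4, w 5, w 6, w 7, w 8]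
    have t3 : (Rmat r i *ᵥ v) 3 ≤ 4 * (q * tot v) := by
      rw [r3]; linarith [w 0, w 1, w 2, w 3, w 4, w 5, w 6, w 7, w 8]
    have t4 : (Rmat r i *ᵥ v) 4 ≤ 4 * (q * tot v) := by
      rw [r4]; linarith [w 0, w 1, w 2, w 3, w 4, w 5, w 6, w 7, w 8]
    have t5 : (Rmat r i *ᵥ v) 5 ≤ 4 * (q * tot v) := by
      rw [r5]; linarith [w 0, w 1, w 2, w 3, w 4, w 5, w 6, w 7, w 8]
    have t6 : (Rmat r i *ᵥ v) 6 ≤ 4 * (q * tot v) := by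
      rw [r6]; linarith [w 0, w 1, w 2, w 3, w 4, w 5, w 6, w 7, w 8]
    have x0 : (goldphi - 1) * (Rmat r i *ᵥ v) 0 ≤ (Rmat r i *ᵥ v) 0 := by
      linarith [mul_le_mul_of_nonneg_right p2 n0]
    have x3 : (goldphi + 1) * (Rmat r i *ᵥ v) 3 ≤ 3 * (Rmat r i *ᵥ v) 3 := by
      linarith [mul_le_mul_of_nonneg_right p2 n3]
    have x6 : (goldphi + 1) * (Rmat r i *ᵥ v) 6 ≤ 3 * (Rmat r i *ᵥ v) 6 := by
      linarith [mul_le_mul_of_nonneg_right p2 n6]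
    have hel : ell v ≤ tot v := by unfold tot; linarith [hv 5, hv 8]
    have he : ell (Rmat r i *ᵥ v) = _ := rfl
    conv_rhs at he => rw [ell]
    have he2 : tot (Rmat r i *ᵥ v) = _ := rfl
    conv_rhs at he2 => rw [tot]
    linarith

/-! ### The sequence -/

lemma diff_ge (r : ℕ → ℕ) (hr : GoodSeq r) (n : ℕ) : n + 1 ≤ r (n + 2) - r (n + 1) := by
  obtain ⟨h1, h2, h3⟩ := hr
  induction n with
  | zero => simp [h1, h2]
  | succ n ih =>
    have := h3 (n + 1) (by omega)
    have e : n + 1 + 2 = n + 3 := rfl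
    have e' : n + 1 + 1 = n + 2 := rfl
    rw [e, e'] at *
    omega

lemma aseq_step (r : ℕ → ℕ) (hr : GoodSeq r) (i : ℕ) (hi : 1 ≤ i) :
    aseq r i + i ≤ aseq r (i + 1) := by
  obtain ⟨n, rfl⟩ : ∃ n, i = n + 1 := ⟨i - 1, by omega⟩
  have := diff_ge r hr n
  have e : n + 1 + 1 = n + 2 := rfl
  unfold aseq
  rw [e]
  have : 1 ≤ r (n + 1) := by
    rcases n with _ | n
    · rw [hr.1]
    · have := diff_ge r hr n
      have e' : n + 1 + 1 = n + 2 := rfl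
      rw [e']; omega
  omega

lemma q_le (r : ℕ → ℕ) (hr : GoodSeq r) (i : ℕ) (hi : 1 ≤ i) :
    goldphi ^ (2 * aseq r i) * (goldphi - 1) ^ (2 * aseq r (i+1)) ≤ (2 / 5 : ℝ) ^ i := by
  have h := aseq_step r hr i hi
  have p1 := phi_lb
  have p2 := phi_ub
  obtain ⟨k, hk⟩ : ∃ k, aseq r (i+1) = aseq r i + (i + k) := ⟨aseq r (i+1) - aseq r i - i, by omega⟩
  rw [hk, mul_add, pow_add, ← mul_assoc, phi_inv_mul, one_mul, mul_add, pow_add, pow_mul]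
  have a1 : (goldphi - 1) ^ 2 ≤ 2 / 5 := by nlinarith [phi_sq]
  have a2 : (goldphi - 1) ^ (2 * k) ≤ 1 := pow_le_one₀ (by linarith) (by linarith)
  have a3 : ((goldphi - 1) ^ 2) ^ i ≤ (2 / 5 : ℝ) ^ i := pow_le_pow_left₀ (sq_nonneg _) a1 i
  have a4 : 0 ≤ ((goldphi - 1) ^ 2) ^ i := by positivity
  calc _ ≤ ((goldphi - 1) ^ 2) ^ i * 1 := mul_le_mul_of_nonneg_left a2 a4
    _ ≤ _ := by linarith

lemma q_eq (r : ℕ → ℕ) (i : ℕ) :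
    goldphi ^ ((-2 : ℤ) * ((aseq r (i+1) : ℤ) - (aseq r i : ℤ))) =
    goldphi ^ (2 * aseq r i) * (goldphi - 1) ^ (2 * aseq r (i+1)) := by
  have hp := phi_pos.ne'
  have : (-2 : ℤ) * ((aseq r (i+1) : ℤ) - (aseq r i : ℤ)) =
      ((2 * aseq r i : ℕ) : ℤ) - ((2 * aseq r (i+1) : ℕ) : ℤ) := by push_cast; ring
  rw [this, zpow_sub₀ hp, zpow_natCast, zpow_natCast, div_eq_mul_inv,
    inv_eq_of_mul_eq_one_right (phi_inv_mul _)]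

/-- The vector `R_i R_{i+2} ⋯ R_{i+2(k-1)} e₂`. -/
noncomputable def wvec (r : ℕ → ℕ) (i k : ℕ) : Fin 9 → ℝ :=
  (((List.range k).map (fun l => Rmat r (i + 2*l))).prod).mulVec (Pi.single (1 : Fin 9) (1 : ℝ))

lemma wvec_succ (r : ℕ → ℕ) (i k : ℕ) :
    wvec r i (k + 1) = Rmat r i *ᵥ wvec r (i + 2) k := by
  unfold wvec
  rw [List.range_succ_eq_map, List.map_cons, List.prod_cons, Matrix.mulVec_mulVec, List.map_map]
  have : (fun l => Rmat r (i + 2 * l)) ∘ Nat.succ = fun l => Rmat r (i + 2 + 2 * l) := by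
    funext l
    simp only [Function.comp]
    congr 1
    omega
  rw [this]
  simp

lemma wvec_zero (r : ℕ → ℕ) (i : ℕ) : wvec r i 0 = Pi.single (1 : Fin 9) (1 : ℝ) := by
  unfold wvec
  rw [List.range_zero, List.map_nil, List.prod_nil, Matrix.one_mulVec]

lemma theta_small (i : ℕ) (hi : 20 ≤ i) : (2 / 5 : ℝ) ^ i ≤ 1 / 1000000 :=
  (pow_le_pow_of_le_one (by norm_num) (by norm_num) hi).trans (by norm_num)

lemma aseq_pos (r : ℕ → ℕ) (hr : GoodSeq r) (i : ℕ) (hi : 20 ≤ i) : 1 ≤ aseq r i := by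
  obtain ⟨n, rfl⟩ : ∃ n, i = n + 1 := ⟨i - 1, by omega⟩
  have := aseq_step r hr n (by omega)
  omega

lemma invariants (r : ℕ → ℕ) (hr : GoodSeq r) (k : ℕ) : ∀ i, 20 ≤ i →
    (∀ j, 0 ≤ wvec r i k j) ∧ 1 - 20 * (2 / 5 : ℝ) ^ i ≤ ell (wvec r i k) ∧
    tot (wvec r i k) ≤ 1 + 400 * (2 / 5 : ℝ) ^ i ∧ 1 / 4 ≤ wvec r i k 1 := by
  induction k with
  | zero =>
    intro i hi
    have h0 : (0 : ℝ) < (2 / 5 : ℝ) ^ i := by positivity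
    rw [wvec_zero]
    refine ⟨?_, ?_, ?_, ?_⟩
    · intro j; fin_cases j <;> simp
    · simp [ell]; exact h0.le
    · simp [tot, ell]; exact h0.le
    · simp; norm_num
  | succ k ih =>
    intro i hi
    obtain ⟨h1, h2, h3, h4⟩ := ih (i + 2) (by omega)
    have ht := theta_small i hi
    have h0 : (0 : ℝ) < (2 / 5 : ℝ) ^ i := by positivity
    have hql := q_le r hr i (by omega)
    have p1 := phi_lb
    have hq0 : 0 ≤ goldphi ^ (2 * aseq r i) * (goldphi - 1) ^ (2 * aseq r (i+1)) := by
      have := phi_pos; exact mul_nonneg (by positivity) (pow_nonneg (by linarith) _)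
    obtain ⟨g1, g2, g3, g4, -⟩ := step r i _ _ h1 rfl (aseq_pos r hr i hi) (by linarith)
    rw [wvec_succ]
    have he : (2 / 5 : ℝ) ^ (i + 2) = (2 / 5) ^ i * (4 / 25) := by rw [pow_add]; norm_num
    rw [he] at h2 h3
    generalize goldphi ^ (2 * aseq r i) * (goldphi - 1) ^ (2 * aseq r (i+1)) = q at *
    generalize (2 / 5 : ℝ) ^ i = t at *
    have b1 : 1 - 20 * t ≤ (1 - 10 * q) * ell (wvec r (i + 2) k) := by
      calc 1 - 20 * t ≤ (1 - 10 * t) * (1 - 20 * (t * (4 / 25))) := by nlinarith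
        _ ≤ _ := by apply mul_le_mul <;> linarith
    refine ⟨g1, by linarith, ?_, by linarith⟩
    calc _ ≤ _ := g3
      _ ≤ (1 + 200 * t) * (1 + 400 * (t * (4 / 25))) := by
          apply mul_le_mul <;> first | linarith | skip
          have : 0 ≤ ell (wvec r (i + 2) k) := by linarith
          unfold tot
          linarith [h1 5, h1 7, h1 8]
      _ ≤ _ := by nlinarith

/-- The 8-th and 9-th coordinates of `w = R_i R_{i+2} ⋯ R_{i+2k} e₂` are comparable to
`φ^{−2(a_{i+1}−a_i)}`, uniformly in `k`, for all sufficiently large `i`. -/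
theorem stmt11 (r : ℕ → ℕ) (hr : GoodSeq r) :
    ∃ i₀ : ℕ, 1 ≤ i₀ ∧ ∃ c C : ℝ, 0 < c ∧ c ≤ C ∧
      ∀ i : ℕ, i₀ ≤ i → ∀ k : ℕ,
        let w := (((List.range (k+1)).map (fun l => Rmat r (i + 2*l))).prod).mulVec
          (Pi.single (1 : Fin 9) (1 : ℝ))
        (c * goldphi ^ ((-2 : ℤ) * ((aseq r (i+1) : ℤ) - (aseq r i : ℤ))) ≤ w 7 ∧
          w 7 ≤ C * goldphi ^ ((-2 : ℤ) * ((aseq r (i+1) : ℤ) - (aseq r i : ℤ)))) ∧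
        (c * goldphi ^ ((-2 : ℤ) * ((aseq r (i+1) : ℤ) - (aseq r i : ℤ))) ≤ w 8 ∧
          w 8 ≤ C * goldphi ^ ((-2 : ℤ) * ((aseq r (i+1) : ℤ) - (aseq r i : ℤ)))) := by
  refine ⟨20, by norm_num, 1 / 16, 80, by norm_num, by norm_num, ?_⟩
  intro i hi k w
  have hw : w = Rmat r i *ᵥ wvec r (i + 2) k := wvec_succ r i k
  obtain ⟨h1, h2, h3, h4⟩ := invariants r hr k (i + 2) (by omega)
  have ht := theta_small i hi
  have ht2 := theta_small (i + 2) (by omega)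
  have hql := q_le r hr i (by omega)
  have p1 := phi_lb
  have hq0 : 0 ≤ goldphi ^ (2 * aseq r i) * (goldphi - 1) ^ (2 * aseq r (i+1)) := by
    have := phi_pos; exact mul_nonneg (by positivity) (pow_nonneg (by linarith) _)
  obtain ⟨-, -, -, -, g5, g6, g7, g8⟩ := step r i _ _ h1 rfl (aseq_pos r hr i hi) (by linarith)
  rw [q_eq, hw]
  generalize goldphi ^ (2 * aseq r i) * (goldphi - 1) ^ (2 * aseq r (i+1)) = q at *
  have e1 : 1 / 16 * q ≤ q / 4 * wvec r (i + 2) k 1 := by nlinarith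
  have e2 : 40 * q * tot (wvec r (i + 2) k) ≤ 80 * q := by nlinarith
  exact ⟨⟨by linarith, by linarith⟩, ⟨by linarith, by linarith⟩⟩
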